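/- Let M be an MDP with target sets F_1,…,F_k, F = ∪_i F_i, every state of F absorbing, α an initial distribution on V∖F, and let y'' be a feasible solution of the multi-objective LP associated with (M, α, F_1,…,F_k) such that Σ_{v∈F_i} y''_v ≥ r_i > 0 for all i = 1,…,k. Let S = {v ∈ V∖F : Σ_{γ∈Γ_v} y''_{(v,γ)} > 0}, and define a memoryless strategy σ by σ(v)(γ) = y''_{(v,γ)} / Σ_{γ'∈Γ_v} y''_{(v,γ')} for v ∈ S (and arbitrarily at states outside S). Then Pr^σ_α(◇F_i) ≥ r_i for all i = 1,…,k (indeed Pr^σ_α(◇F_i) = Σ_{v∈F_i} y''_v for all i for which the flow graph of y'' reaches F_i only through S). -/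

import Mathlib

open scoped BigOperators
open MeasureTheory

/-- A finite-state Markov decision process: a finite set of states `V`, a finite
action alphabet `A`, a nonempty set of enabled actions at each state, and for each
state and enabled action a probability distribution on next states. -/
structure MDP (V A : Type) [Fintype V] [Fintype A] where
  enabled : V → Finset A
  enabled_nonempty : ∀ v, (enabled v).Nonempty
  p : V → A → V → ℝ
  p_nonneg : ∀ v a v', 0 ≤ p v a v'
  p_sum : ∀ v, ∀ a ∈ enabled v, ∑ v', p v a v' = 1

namespace MDP

variable {V A : Type} [Fintype V] [Fintype A]

/-- A (history-dependent, randomized) strategy: given the list of past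
(state, action) pairs (most recent first) and the current state, a probability
distribution on actions, supported on the enabled actions. -/
structure Strategy (M : MDP V A) where
  act : List (V × A) → V → A → ℝ
  act_nonneg : ∀ h v a, 0 ≤ act h v a
  act_support : ∀ h v a, a ∉ M.enabled v → act h v a = 0
  act_sum : ∀ h v, ∑ a, act h v a = 1

/-- A strategy is memoryless (stationary) if it depends only on the current state. -/
def Strategy.Memoryless {M : MDP V A} (σ : M.Strategy) : Prop :=
  ∀ h h' v, σ.act h v = σ.act h' v

/-- A strategy is pure (deterministic) if it always plays a single action with
probability 1. -/
def Strategy.Pure {M : MDP V A} (σ : M.Strategy) : Prop :=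
  ∀ h v, ∃ a, σ.act h v a = 1

/-- `α` is a probability distribution on `V`. -/
def IsDist (α : V → ℝ) : Prop :=
  (∀ v, 0 ≤ α v) ∧ ∑ v, α v = 1

/-- The point (Dirac) distribution at `u`. -/
def diracD [DecidableEq V] (u : V) : V → ℝ := fun v => if v = u then 1 else 0

/-- The `m`-th binary digit of `x`. -/
noncomputable def bit (m : ℕ) (x : ℝ) : ℝ :=
  if ⌊x * 2 ^ (m + 1)⌋ % 2 = 1 then 1 else 0

/-- Extracts from a single seed `x ∈ [0,1]` a sequence of independent uniform
`[0,1]` samples, by splitting the binary digits of `x`. -/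
noncomputable def unif (k : ℕ) (x : ℝ) : ℝ :=
  ∑' n : ℕ, bit (Nat.pair k n) x / 2 ^ (n + 1)

/-- Inverse-CDF sampling from a distribution `q` on a finite type, using the
uniform sample `u`. -/
noncomputable def sample {S : Type} [Fintype S] [Nonempty S] (q : S → ℝ) (u : ℝ) : S :=
  let e := Fintype.equivFin S
  if h : (Finset.univ.filter fun i => u < ∑ j ∈ Finset.Iic i, q (e.symm j)).Nonempty then
    e.symm ((Finset.univ.filter fun i => u < ∑ j ∈ Finset.Iic i, q (e.symm j)).min' h)
  else Classical.arbitrary S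

variable [Nonempty V] [Nonempty A]

/-- The random run of `M` under strategy `σ` from initial distribution `α`, driven by
the random seed `x`: at time `n` it returns the list of past (state, action) pairs
(most recent first) together with the current state and the action chosen there. -/
noncomputable def run (M : MDP V A) (σ : M.Strategy) (α : V → ℝ) (x : ℝ) :
    ℕ → List (V × A) × (V × A)
  | 0 =>
      let s := sample α (unif 0 x)
      ([], (s, sample (σ.act [] s) (unif 1 x)))
  | n + 1 =>
      let r := run M σ α x n
      let s' := sample (M.p r.2.1 r.2.2) (unif (2 * n + 2) x)
      (r.2 :: r.1, (s', sample (σ.act (r.2 :: r.1) s') (unif (2 * n + 3) x)))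

/-- The state at time `n` of the run driven by seed `x`. -/
noncomputable def stateAt (M : MDP V A) (σ : M.Strategy) (α : V → ℝ) (x : ℝ) (n : ℕ) : V :=
  (M.run σ α x n).2.1

/-- The probability, under strategy `σ` from initial distribution `α`, that the
infinite trajectory of states belongs to the event `E`. -/
noncomputable def PrEvent (M : MDP V A) (σ : M.Strategy) (α : V → ℝ) (E : Set (ℕ → V)) : ℝ :=
  (volume {x : ℝ | x ∈ Set.Icc (0 : ℝ) 1 ∧ M.stateAt σ α x ∈ E}).toReal

/-- The probability of eventually visiting the set `F` (the event `◇F`). -/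
noncomputable def PrReach (M : MDP V A) (σ : M.Strategy) (α : V → ℝ) (F : Set V) : ℝ :=
  M.PrEvent σ α {w | ∃ n, w n ∈ F}

/-- A state is absorbing if it has a single enabled action, which loops on it with
probability 1. -/
def Absorbing (M : MDP V A) (v : V) : Prop :=
  ∃ a, M.enabled v = {a} ∧ M.p v a v = 1

/-- One positive-probability step of the underlying graph of the MDP. -/
def Step (M : MDP V A) (v v' : V) : Prop :=
  ∃ a ∈ M.enabled v, 0 < M.p v a v'

/-- The MDP is cleaned-up w.r.t. `F`: from every state there is a path of
positive-probability transitions reaching `F`. -/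
def CleanedUp (M : MDP V A) (F : Set V) : Prop :=
  ∀ v, ∃ w ∈ F, Relation.ReflTransGen M.Step v w

end MDP

namespace MDP

variable {V A : Type} [Fintype V] [Fintype A]

/-- Feasibility for the multi-objective LP associated with `(M, α, F)`:
`y` are the variables `y_{(v,γ)}` (for `v ∉ F`), `yF` the variables `y_v` (for `v ∈ F`). -/
def LPFeasible [DecidableEq V] (M : MDP V A) (α : V → ℝ) (F : Finset V)
    (y : V → A → ℝ) (yF : V → ℝ) : Prop :=
  (∀ v ∉ F, (∑ a ∈ M.enabled v, y v a) -
      (∑ v' ∈ Fᶜ, ∑ a' ∈ M.enabled v', M.p v' a' v * y v' a') = α v) ∧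
  (∀ v ∈ F, yF v - (∑ v' ∈ Fᶜ, ∑ a' ∈ M.enabled v', M.p v' a' v * y v' a') = 0) ∧
  (∀ v ∈ F, 0 ≤ yF v) ∧
  (∀ v ∉ F, ∀ a ∈ M.enabled v, 0 ≤ y v a)

/-- The substochastic matrix `P^σ` on `V ∖ F` induced by a memoryless strategy `σ`. -/
noncomputable def Pmat [DecidableEq V] (M : MDP V A) (σ : M.Strategy) (F : Finset V) :
    Matrix {v : V // v ∉ F} {v : V // v ∉ F} ℝ :=
  Matrix.of fun v v' => ∑ a ∈ M.enabled v.1, σ.act [] v.1 a * M.p v.1 a v'.1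

end MDP

section DigitLaws

open ProbabilityTheory

/-- The uniform distribution on `[0, 1)`. -/
noncomputable abbrev uniformUnit : Measure ℝ := volume.restrict (Set.Ico 0 1)

/-- The fair coin, as a measure on the two binary digits. -/
noncomputable abbrev fairDigit : Measure (Fin 2) := (PMF.uniformOfFintype (Fin 2)).toMeasure

instance : IsProbabilityMeasure uniformUnit := ⟨by simp⟩

lemma measurable_binaryDigits : Measurable fun x : ℝ ↦ Real.digits x 2 := by
  refine measurable_pi_iff.2 fun i ↦ ?_
  exact (measurable_of_countable (Fin.ofNat 2)).comp
    (Nat.measurable_floor.comp (measurable_id.mul_const _))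

lemma fairDigit_singleton (d : Fin 2) : fairDigit {d} = 2⁻¹ := by
  simp [fairDigit]

/-- The points of `[0, 1)` with a prescribed binary prefix form a dyadic interval. -/
lemma exists_binaryPrefix_iff_floor (s : ℕ → Fin 2) (n : ℕ) :
    ∃ K : ℕ, K < 2 ^ n ∧ ∀ x : ℝ, x ∈ Set.Ico (0 : ℝ) 1 →
      ((∀ i < n, Real.digits x 2 i = s i) ↔ ⌊x * 2 ^ n⌋₊ = K) := by
  induction n with
  | zero => exact ⟨0, by simp, fun x hx ↦ by simp [Nat.floor_eq_zero, hx.2]⟩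
  | succ n ih =>
    obtain ⟨K, hK, h⟩ := ih
    refine ⟨2 * K + s n, by have := (s n).2; rw [pow_succ]; omega, fun x hx ↦ ?_⟩
    have h2 : ⌊x * 2 ^ n⌋₊ = ⌊x * 2 ^ (n + 1)⌋₊ / 2 := by
      rw [← Nat.floor_div_ofNat]
      congr 1
      rw [pow_succ]
      ring
    have hd : Real.digits x 2 n = s n ↔ ⌊x * 2 ^ (n + 1)⌋₊ % 2 = s n := by
      simp [Real.digits, Fin.ext_iff]
    rw [Nat.forall_lt_succ_right, h x hx, hd, h2]
    have := (s n).2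
    omega

lemma uniformUnit_binaryPrefix (s : ℕ → Fin 2) (n : ℕ) :
    uniformUnit {x | ∀ i < n, Real.digits x 2 i = s i} = 2⁻¹ ^ n := by
  obtain ⟨K, hK, h⟩ := exists_binaryPrefix_iff_floor s n
  have hp : (0 : ℝ) < 2 ^ n := by positivity
  have hset : {x : ℝ | ∀ i < n, Real.digits x 2 i = s i} ∩ Set.Ico 0 1 =
      Set.Ico ((K : ℝ) / 2 ^ n) ((K + 1) / 2 ^ n) := by
    ext x
    have hK' : (K : ℝ) + 1 ≤ 2 ^ n := by exact_mod_cast hK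
    simp only [Set.mem_inter_iff, Set.mem_ofPred_eq, Set.mem_Ico]
    rw [div_le_iff₀ hp, lt_div_iff₀ hp]
    constructor
    · rintro ⟨h1, h2⟩
      have := (h x h2).1 h1
      exact (Nat.floor_eq_iff (mul_nonneg h2.1 hp.le)).1 this
    · rintro ⟨h1, h2⟩
      have h0 : 0 ≤ x * 2 ^ n := (Nat.cast_nonneg K).trans h1
      have hx : 0 ≤ x := nonneg_of_mul_nonneg_left h0 hp
      have hx' : x < 1 := by
        by_contra hc
        nlinarith [not_lt.1 hc]
      exact ⟨(h x ⟨hx, hx'⟩).2 ((Nat.floor_eq_iff h0).2 ⟨h1, h2⟩), hx, hx'⟩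
  rw [Measure.restrict_apply' measurableSet_Ico, hset, Real.volume_Ico, ← sub_div,
    add_sub_cancel_left, ENNReal.ofReal_div_of_pos hp, ENNReal.ofReal_pow (by norm_num)]
  simp [ENNReal.inv_pow]

/-- The binary digits of a uniform point of `[0, 1)` are independent fair coins. -/
lemma map_binaryDigits_uniformUnit :
    uniformUnit.map (fun x ↦ Real.digits x 2) = Measure.infinitePi fun _ : ℕ ↦ fairDigit := by
  refine (isProjectiveLimit_nat_iff (isProjectiveMeasureFamily_pi fun _ : ℕ ↦ fairDigit) _ |>.2 fun n ↦ ?_).unique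
    (Measure.isProjectiveLimit_infinitePi _)
  refine Measure.ext_of_singleton fun s ↦ ?_
  rw [Measure.map_apply (by fun_prop) (measurableSet_singleton _),
    Measure.map_apply measurable_binaryDigits (Preorder.measurable_frestrictLe n
      (measurableSet_singleton _)), Measure.pi_singleton]
  simp only [fairDigit_singleton, Finset.prod_const, Finset.card_univ, Fintype.card_coe,
    Nat.card_Iic]
  rw [← uniformUnit_binaryPrefix (fun i ↦ if h : i ∈ Finset.Iic n then s ⟨i, h⟩ else 0)]
  congr 1
  ext x
  simp only [Set.mem_preimage, Set.mem_singleton_iff, funext_iff, Set.mem_ofPred_eq,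
    Preorder.frestrictLe_apply, Subtype.forall]
  refine forall_congr' fun i ↦ ?_
  constructor
  · intro h hi
    have hi' : i ∈ Finset.Iic n := by simpa [Nat.lt_succ_iff] using hi
    rw [h hi', dif_pos hi']
  · intro h hi
    have := h (by simpa [Nat.lt_succ_iff] using hi)
    rwa [dif_pos hi] at this

lemma measurable_ofBinaryDigits : Measurable (Real.ofDigits : (ℕ → Fin 2) → ℝ) :=
  Real.continuous_ofDigits.measurable

/-- A binary expansion with independent fair digits is uniform. -/
lemma map_ofBinaryDigits_infinitePi :
    (Measure.infinitePi fun _ : ℕ ↦ fairDigit).map Real.ofDigits = uniformUnit := by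
  rw [← map_binaryDigits_uniformUnit, Measure.map_map measurable_ofBinaryDigits
    measurable_binaryDigits]
  refine (Measure.map_congr ?_).trans Measure.map_id
  filter_upwards [ae_restrict_mem measurableSet_Ico] with x hx
  exact Real.ofDigits_digits one_lt_two hx

namespace MDP

lemma unif_eq_ofDigits {x : ℝ} (hx : 0 ≤ x) (k : ℕ) :
    unif k x = Real.ofDigits fun n ↦ Real.digits x 2 (Nat.pair k n) := by
  refine tsum_congr fun n ↦ ?_
  rw [Real.ofDigitsTerm, div_eq_mul_inv]
  congr 1
  have h : (⌊x * 2 ^ (Nat.pair k n + 1)⌋ : ℤ) = (⌊x * 2 ^ (Nat.pair k n + 1)⌋₊ : ℕ) :=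
    (Int.natCast_floor_eq_floor (by positivity)).symm
  rw [bit, h]
  simp only [Real.digits, Fin.ofNat, Nat.cast_ofNat]
  rcases Nat.mod_two_eq_zero_or_one ⌊x * 2 ^ (Nat.pair k n + 1)⌋₊ with h0 | h0
  · rw [if_neg (by omega), h0]; simp
  · rw [if_pos (by omega), h0]; simp

lemma measurable_unif (k : ℕ) : Measurable (unif k) := by
  refine Measurable.tsum fun n ↦ Measurable.div_const ?_ _
  refine Measurable.ite ?_ measurable_const measurable_const
  exact (Int.measurable_floor.comp (measurable_id.mul_const _))
    (MeasurableSet.of_discrete (s := {z : ℤ | z % 2 = 1}))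

/-- The numbers `unif k x`, for a uniform seed `x`, are independent and uniform. -/
lemma map_unif_uniformUnit :
    uniformUnit.map (fun x k ↦ unif k x) = Measure.infinitePi fun _ : ℕ ↦ uniformUnit := by
  have hm : Measurable fun (ω : ℕ → Fin 2) (k : ℕ) ↦
      Real.ofDigits fun n ↦ ω (Nat.pair k n) :=
    measurable_pi_iff.2 fun k ↦ measurable_ofBinaryDigits.comp (by fun_prop)
  have h1 : (fun (x : ℝ) (k : ℕ) ↦ unif k x) =ᵐ[uniformUnit]
      (fun (ω : ℕ → Fin 2) (k : ℕ) ↦ Real.ofDigits fun n ↦ ω (Nat.pair k n)) ∘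
        fun x ↦ Real.digits x 2 := by
    filter_upwards [ae_restrict_mem measurableSet_Ico] with x hx
    funext k
    exact unif_eq_ofDigits hx.1 k
  rw [Measure.map_congr h1, ← Measure.map_map hm measurable_binaryDigits,
    map_binaryDigits_uniformUnit,
    ← Measure.infinitePi_map_piCongrLeft (fun _ : ℕ ↦ fairDigit) Nat.pairEquiv,
    Measure.map_map hm (by fun_prop)]
  have h2 : (fun (ω : ℕ → Fin 2) (k : ℕ) ↦ Real.ofDigits fun n ↦ ω (Nat.pair k n)) ∘
      MeasurableEquiv.piCongrLeft (fun _ ↦ Fin 2) Nat.pairEquiv =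
      (fun (ω : ℕ → ℕ → Fin 2) (k : ℕ) ↦ Real.ofDigits (ω k)) ∘
        MeasurableEquiv.curry ℕ ℕ (Fin 2) := by
    funext ω k
    simp only [Function.comp_apply]
    congr 1
    funext n
    exact MeasurableEquiv.piCongrLeft_apply_apply (β := fun _ ↦ Fin 2) Nat.pairEquiv ω (k, n)
  have hm' : Measurable fun (ω : ℕ → ℕ → Fin 2) (k : ℕ) ↦ Real.ofDigits (ω k) :=
    measurable_pi_iff.2 fun k ↦ measurable_ofBinaryDigits.comp (measurable_pi_apply k)
  rw [h2, ← Measure.map_map hm' (by fun_prop),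
    Measure.infinitePi_map_curry (fun _ _ : ℕ ↦ fairDigit),
    Measure.infinitePi_map_pi _ fun _ ↦ measurable_ofBinaryDigits]
  simp_rw [map_ofBinaryDigits_infinitePi]

lemma map_unif (k : ℕ) : uniformUnit.map (unif k) = uniformUnit := by
  calc uniformUnit.map (unif k)
      = (uniformUnit.map fun x k ↦ unif k x).map fun ω ↦ ω k :=
        (Measure.map_map (measurable_pi_apply k) (measurable_pi_iff.2 measurable_unif)).symm
    _ = uniformUnit := by rw [map_unif_uniformUnit, Measure.infinitePi_map_eval]

lemma iIndepFun_unif : iIndepFun unif uniformUnit := by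
  rw [iIndepFun_iff_map_fun_eq_infinitePi_map measurable_unif, map_unif_uniformUnit]
  simp_rw [map_unif]

end MDP

end DigitLaws

section RunLaws

open ProbabilityTheory

namespace MDP

variable {S : Type} [Fintype S] [Nonempty S]

lemma measurable_sample [MeasurableSpace S] (q : S → ℝ) : Measurable (sample q) := by
  classical
  have h : sample q = (fun b : Fin (Fintype.card S) → Prop ↦
      if h : (Finset.univ.filter fun i ↦ b i).Nonempty then
        (Fintype.equivFin S).symm ((Finset.univ.filter fun i ↦ b i).min' h)
      else Classical.arbitrary S) ∘
      fun u i ↦ u < ∑ j ∈ Finset.Iic i, q ((Fintype.equivFin S).symm j) := by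
    funext u
    simp only [sample, Function.comp_apply]
  rw [h]
  refine (measurable_of_finite _).comp (measurable_pi_iff.2 fun i ↦ ?_)
  exact measurableSet_setOfPred.1 measurableSet_Iio

/-- Inverse-CDF sampling with a uniform seed produces the prescribed distribution. -/
lemma uniformUnit_sample_eq {q : S → ℝ} (hq : IsDist q) (s : S) :
    uniformUnit {u | sample q u = s} = ENNReal.ofReal (q s) := by
  classical
  set e := Fintype.equivFin S
  set C : Fin (Fintype.card S) → ℝ := fun i ↦ ∑ j ∈ Finset.Iic i, q (e.symm j) with hC
  have hq0 : ∀ j, 0 ≤ q (e.symm j) := fun j ↦ hq.1 _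
  have hq1 : ∑ j, q (e.symm j) = 1 := by rw [Equiv.sum_comp e.symm q]; exact hq.2
  set i := e s with hi
  set D : ℝ := ∑ j ∈ Finset.Iio i, q (e.symm j) with hD
  have hCD : C i = D + q s := by
    simp only [hC, hD]
    rw [← Finset.Iio_insert i, Finset.sum_insert (by simp)]
    simp [hi, add_comm]
  have hD0 : 0 ≤ D := Finset.sum_nonneg fun j _ ↦ hq0 j
  have hC1 : C i ≤ 1 := hq1 ▸
    Finset.sum_le_sum_of_subset_of_nonneg (Finset.subset_univ _) fun j _ _ ↦ hq0 j
  have hDle : ∀ u : ℝ, 0 ≤ u → (D ≤ u ↔ ∀ j < i, C j ≤ u) := by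
    intro u hu
    constructor
    · intro h j hj
      refine le_trans (Finset.sum_le_sum_of_subset_of_nonneg ?_ fun j _ _ ↦ hq0 j) h
      intro l hl
      simp only [Finset.mem_Iic, Finset.mem_Iio] at hl ⊢
      exact hl.trans_lt hj
    · intro h
      rcases (Finset.Iio i).eq_empty_or_nonempty with h0 | h0
      · simpa [hD, h0] using hu
      · have hj := Finset.max'_mem _ h0
        refine le_trans (Finset.sum_le_sum_of_subset_of_nonneg ?_ fun j _ _ ↦ hq0 j)
          (h _ (Finset.mem_Iio.1 hj))
        intro l hl
        exact Finset.mem_Iic.2 (Finset.le_max' _ _ hl)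
  have hset : {u | sample q u = s} ∩ Set.Ico 0 1 = Set.Ico D (C i) := by
    ext u
    have hkey : 0 ≤ u → u < 1 → (sample q u = s ↔ D ≤ u ∧ u < C i) := by
      intro hu0 hu1
      have hne : (Finset.univ.filter fun i ↦ u < C i).Nonempty := by
        have : 0 < Fintype.card S := Fintype.card_pos
        refine ⟨⟨Fintype.card S - 1, by omega⟩, ?_⟩
        simp only [Finset.mem_filter, Finset.mem_univ, true_and]
        have hall : Finset.Iic (⟨Fintype.card S - 1, by omega⟩ : Fin (Fintype.card S)) =
            Finset.univ := by
          ext l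
          simp only [Finset.mem_Iic, Finset.mem_univ, iff_true, Fin.le_def]
          omega
        simp only [hC, hall, hq1]
        exact hu1
      have hs : sample q u = e.symm ((Finset.univ.filter fun i ↦ u < C i).min' hne) := by
        simp only [sample]
        exact dif_pos hne
      rw [hs, Equiv.symm_apply_eq, Finset.min'_eq_iff, hDle u hu0]
      simp only [Finset.mem_filter, Finset.mem_univ, true_and, ← hi]
      rw [and_comm]
      refine and_congr_left fun _ ↦ forall_congr' fun j ↦ ?_
      rw [← not_lt, ← not_lt, imp_not_comm, not_lt]
    simp only [Set.mem_inter_iff, Set.mem_ofPred_eq, Set.mem_Ico]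
    constructor
    · rintro ⟨h, h0, h1⟩
      exact (hkey h0 h1).1 h
    · rintro ⟨h0, h1⟩
      have h0' := hD0.trans h0
      have h1' := h1.trans_le hC1
      exact ⟨(hkey h0' h1').2 ⟨h0, h1⟩, h0', h1'⟩
  rw [Measure.restrict_apply' measurableSet_Ico, hset, Real.volume_Ico, hCD, add_sub_cancel_left]

/-- The `σ`-algebra generated by the first `k` uniform samples. -/
noncomputable abbrev seedsBefore (k : ℕ) : MeasurableSpace ℝ :=
  ⨆ i ∈ Set.Iio k, MeasurableSpace.comap (unif i) inferInstance

lemma seedsBefore_mono {k l : ℕ} (h : k ≤ l) : seedsBefore k ≤ seedsBefore l :=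
  biSup_mono fun _ hi ↦ lt_of_lt_of_le hi h

lemma measurable_unif_seedsBefore {k l : ℕ} (h : k < l) : Measurable[seedsBefore l] (unif k) :=
  measurable_iff_comap_le.2 (le_biSup (fun i ↦ MeasurableSpace.comap (unif i) inferInstance)
    (show k ∈ Set.Iio l from h))

lemma seedsBefore_le (k : ℕ) : seedsBefore k ≤ (inferInstance : MeasurableSpace ℝ) :=
  iSup₂_le fun i _ ↦ (measurable_unif i).comap_le

lemma indep_seedsBefore_unif (k : ℕ) :
    Indep (seedsBefore k) (MeasurableSpace.comap (unif k) inferInstance) uniformUnit := by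
  have h := indep_iSup_of_disjoint (fun i ↦ (measurable_unif i).comap_le) iIndepFun_unif
    (S := Set.Iio k) (T := {k}) (by simp)
  simpa only [Set.mem_singleton_iff, iSup_iSup_eq_left] using h

/-- Sampling with a fresh seed from a distribution indexed by `X`, where `X` depends only on
earlier seeds. -/
lemma uniformUnit_and_sample_eq {R : Type} [MeasurableSpace R] [MeasurableSingletonClass R]
    {k : ℕ} {X : ℝ → R} (hX : Measurable[seedsBefore k] X) {q : S → ℝ} (hq : IsDist q)
    (r : R) (s : S) :
    uniformUnit {x | X x = r ∧ sample q (unif k x) = s} =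
      uniformUnit {x | X x = r} * ENNReal.ofReal (q s) := by
  let _ : MeasurableSpace S := ⊤
  have h := (Indep_iff _ _ _).1 (indep_seedsBefore_unif k) {x | X x = r}
    {x | sample q (unif k x) = s} (hX (measurableSet_singleton r))
    ⟨{u | sample q u = s}, measurable_sample q (MeasurableSet.of_discrete (s := {s})), rfl⟩
  refine h.trans ?_
  congr 1
  rw [← uniformUnit_sample_eq hq s]
  conv_rhs => rw [← map_unif k]
  exact (Measure.map_apply (measurable_unif k)
    (measurable_sample q (MeasurableSet.of_discrete (s := {s})))).symm

lemma measurable_sample_comp {R T : Type} [Countable R] [MeasurableSpace R]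
    [MeasurableSingletonClass R] [Fintype T] [Nonempty T] [MeasurableSpace T]
    {Ω : Type} {mΩ : MeasurableSpace Ω} {Y : Ω → R} {W : Ω → ℝ} (hY : Measurable Y)
    (hW : Measurable W) (q : R → T → ℝ) : Measurable fun ω ↦ sample (q (Y ω)) (W ω) := by
  have : Measurable fun z : R × ℝ ↦ sample (q z.1) z.2 :=
    measurable_from_prod_countable_right fun r ↦ measurable_sample (q r)
  exact this.comp (hY.prodMk hW)

end MDP

end RunLaws

section Memoryless

namespace MDP

variable {V A : Type} [Fintype V] [Fintype A]

/-- The one-step transition matrix induced by a memoryless strategy. -/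
noncomputable def transition (M : MDP V A) (σ : M.Strategy) (v v' : V) : ℝ :=
  ∑ a, σ.act [] v a * M.p v a v'

/-- The distribution of the state at time `n` under a memoryless strategy. -/
noncomputable def stateDist (M : MDP V A) (σ : M.Strategy) (α : V → ℝ) : ℕ → V → ℝ
  | 0 => α
  | n + 1 => fun v' ↦ ∑ v, stateDist M σ α n v * M.transition σ v v'

lemma transition_nonneg (M : MDP V A) (σ : M.Strategy) (v v' : V) : 0 ≤ M.transition σ v v' :=
  Finset.sum_nonneg fun _ _ ↦ mul_nonneg (σ.act_nonneg _ _ _) (M.p_nonneg _ _ _)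

lemma stateDist_nonneg (M : MDP V A) (σ : M.Strategy) {α : V → ℝ} (hα : IsDist α) (n : ℕ) (v : V) :
    0 ≤ M.stateDist σ α n v := by
  induction n generalizing v with
  | zero => exact hα.1 v
  | succ n ih => exact Finset.sum_nonneg fun w _ ↦ mul_nonneg (ih w) (M.transition_nonneg σ w v)

lemma transition_eq_sum_enabled (M : MDP V A) (σ : M.Strategy) (v v' : V) :
    M.transition σ v v' = ∑ a ∈ M.enabled v, σ.act [] v a * M.p v a v' := by
  refine (Finset.sum_subset (Finset.subset_univ _) fun a _ ha ↦ ?_).symm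
  rw [σ.act_support _ _ _ ha, zero_mul]

lemma sum_transition (M : MDP V A) (σ : M.Strategy) (v : V) : ∑ v', M.transition σ v v' = 1 := by
  simp_rw [transition_eq_sum_enabled]
  rw [Finset.sum_comm]
  simp_rw [← Finset.mul_sum]
  rw [Finset.sum_congr rfl fun a ha ↦ by rw [M.p_sum v a ha, mul_one], ← σ.act_sum [] v]
  exact Finset.sum_subset (Finset.subset_univ _) fun a _ ha ↦ σ.act_support _ _ _ ha

variable [Nonempty V] [Nonempty A]

/-- The state together with the action chosen at time `n`. -/
noncomputable def stateActionAt (M : MDP V A) (σ : M.Strategy) (α : V → ℝ) (n : ℕ) (x : ℝ) :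
    V × A :=
  (M.run σ α x n).2

lemma stateAt_succ (M : MDP V A) (σ : M.Strategy) (α : V → ℝ) (x : ℝ) (n : ℕ) :
    M.stateAt σ α x (n + 1) = sample (M.p (M.stateActionAt σ α n x).1 (M.stateActionAt σ α n x).2)
      (unif (2 * n + 2) x) :=
  rfl

lemma stateActionAt_eq (M : MDP V A) {σ : M.Strategy} (hσ : σ.Memoryless) (α : V → ℝ) (x : ℝ)
    (n : ℕ) :
    M.stateActionAt σ α n x = (M.stateAt σ α x n,
      sample (σ.act [] (M.stateAt σ α x n)) (unif (2 * n + 1) x)) := by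
  cases n with
  | zero => rfl
  | succ n =>
    rw [← hσ ((M.run σ α x n).2 :: (M.run σ α x n).1) []]
    rfl

section Law

variable [MeasurableSpace V] [DiscreteMeasurableSpace V] [MeasurableSpace A]

lemma measurable_stateActionAt_of_stateAt (M : MDP V A) {σ : M.Strategy} (hσ : σ.Memoryless)
    (α : V → ℝ) {n : ℕ} (h : Measurable[seedsBefore (2 * n + 1)] fun x ↦ M.stateAt σ α x n) :
    Measurable[seedsBefore (2 * n + 2)] (M.stateActionAt σ α n) := by
  have h' := h.mono (seedsBefore_mono (by omega : 2 * n + 1 ≤ 2 * n + 2)) le_rfl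
  rw [funext (M.stateActionAt_eq hσ α · n)]
  exact h'.prodMk (measurable_sample_comp h' (measurable_unif_seedsBefore (by omega)) _)

variable [DiscreteMeasurableSpace A]

lemma measurable_stateAt (M : MDP V A) {σ : M.Strategy} (hσ : σ.Memoryless) (α : V → ℝ) (n : ℕ) :
    Measurable[seedsBefore (2 * n + 1)] fun x ↦ M.stateAt σ α x n := by
  induction n with
  | zero => exact (measurable_sample α).comp (measurable_unif_seedsBefore (by omega))
  | succ n ih =>
    exact measurable_sample_comp (R := V × A) (q := fun z ↦ M.p z.1 z.2)
      ((M.measurable_stateActionAt_of_stateAt hσ α ih).mono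
        (seedsBefore_mono (by omega)) le_rfl) (measurable_unif_seedsBefore (by omega))

lemma measurable_stateActionAt (M : MDP V A) {σ : M.Strategy} (hσ : σ.Memoryless) (α : V → ℝ)
    (n : ℕ) : Measurable[seedsBefore (2 * n + 2)] (M.stateActionAt σ α n) :=
  M.measurable_stateActionAt_of_stateAt hσ α (M.measurable_stateAt hσ α n)

lemma uniformUnit_stateActionAt (M : MDP V A) {σ : M.Strategy} (hσ : σ.Memoryless) (α : V → ℝ)
    (n : ℕ) (v : V) (a : A) :
    uniformUnit {x | M.stateActionAt σ α n x = (v, a)} =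
      uniformUnit {x | M.stateAt σ α x n = v} * ENNReal.ofReal (σ.act [] v a) := by
  rw [← uniformUnit_and_sample_eq (M.measurable_stateAt hσ α n)
    ⟨σ.act_nonneg [] v, σ.act_sum [] v⟩]
  congr 1
  ext x
  simp only [Set.mem_ofPred_eq, M.stateActionAt_eq hσ, Prod.mk.injEq]
  exact and_congr_right fun h ↦ by rw [h]

/-- Under a memoryless strategy the run is the Markov chain with the induced transitions. -/
lemma uniformUnit_stateAt (M : MDP V A) {σ : M.Strategy} (hσ : σ.Memoryless) {α : V → ℝ}
    (hα : IsDist α) (n : ℕ) (v : V) :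
    uniformUnit {x | M.stateAt σ α x n = v} = ENNReal.ofReal (M.stateDist σ α n v) := by
  induction n generalizing v with
  | zero =>
    rw [stateDist, ← uniformUnit_sample_eq hα v]
    conv_rhs => rw [← map_unif 0]
    exact (Measure.map_apply (measurable_unif 0)
      (measurable_sample α (MeasurableSet.of_discrete (s := {v})))).symm
  | succ n ih =>
    have hunion : {x | M.stateAt σ α x (n + 1) = v} = ⋃ z : V × A,
        {x | M.stateActionAt σ α n x = z ∧ sample (M.p z.1 z.2) (unif (2 * n + 2) x) = v} := by
      ext x
      simp [stateAt_succ]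
    have hmeas (z : V × A) : MeasurableSet
        {x | M.stateActionAt σ α n x = z ∧ sample (M.p z.1 z.2) (unif (2 * n + 2) x) = v} :=
      ((seedsBefore_le _) _ (M.measurable_stateActionAt hσ α n (measurableSet_singleton z))).inter
        (((measurable_sample _).comp (measurable_unif _)) (measurableSet_singleton v))
    have hdisj : Pairwise (Function.onFun Disjoint fun z : V × A ↦
        {x | M.stateActionAt σ α n x = z ∧ sample (M.p z.1 z.2) (unif (2 * n + 2) x) = v}) := by
      intro z z' hz
      refine Set.disjoint_left.2 fun x hx hx' ↦ hz ?_
      exact hx.1.symm.trans hx'.1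
    have hterm (z : V × A) : uniformUnit
        {x | M.stateActionAt σ α n x = z ∧ sample (M.p z.1 z.2) (unif (2 * n + 2) x) = v} =
        ENNReal.ofReal (M.stateDist σ α n z.1 * (σ.act [] z.1 z.2 * M.p z.1 z.2 v)) := by
      have hz := M.uniformUnit_stateActionAt hσ α n z.1 z.2
      rw [ih] at hz
      by_cases ha : z.2 ∈ M.enabled z.1
      · rw [uniformUnit_and_sample_eq (M.measurable_stateActionAt hσ α n)
          ⟨M.p_nonneg _ _, M.p_sum _ _ ha⟩, hz, ENNReal.ofReal_mul (M.stateDist_nonneg σ hα _ _),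
          ENNReal.ofReal_mul (σ.act_nonneg _ _ _), mul_assoc]
      · rw [σ.act_support _ _ _ ha] at hz ⊢
        simp only [zero_mul, mul_zero, ENNReal.ofReal_zero] at hz ⊢
        exact measure_mono_null (fun x hx ↦ hx.1) hz
    rw [hunion, measure_iUnion hdisj hmeas, tsum_fintype]
    simp_rw [hterm]
    rw [← ENNReal.ofReal_sum_of_nonneg fun z _ ↦ mul_nonneg (M.stateDist_nonneg σ hα _ _)
      (mul_nonneg (σ.act_nonneg _ _ _) (M.p_nonneg _ _ _)), Fintype.sum_prod_type]
    simp_rw [← Finset.mul_sum]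
    rfl

end Law

/-- The probability of reaching `F` is at least that of being in `F` at time `n`. -/
lemma sum_stateDist_le_PrReach (M : MDP V A) {σ : M.Strategy} (hσ : σ.Memoryless) {α : V → ℝ}
    (hα : IsDist α) (n : ℕ) (F : Finset V) :
    ∑ v ∈ F, M.stateDist σ α n v ≤ M.PrReach σ α (↑F : Set V) := by
  let _ : MeasurableSpace V := ⊤
  let _ : MeasurableSpace A := ⊤
  have hsub : {x | M.stateAt σ α x n ∈ F} ∩ Set.Ico (0 : ℝ) 1 ⊆
      {x | x ∈ Set.Icc (0 : ℝ) 1 ∧ M.stateAt σ α x ∈ {w | ∃ n, w n ∈ (↑F : Set V)}} :=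
    fun x hx ↦ ⟨Set.Ico_subset_Icc_self hx.2, n, hx.1⟩
  have hfin : volume
      {x | x ∈ Set.Icc (0 : ℝ) 1 ∧ M.stateAt σ α x ∈ {w | ∃ n, w n ∈ (↑F : Set V)}} ≠ ⊤ :=
    ((measure_mono fun x hx ↦ hx.1).trans_lt measure_Icc_lt_top).ne
  have hF : uniformUnit {x | M.stateAt σ α x n ∈ F} =
      ENNReal.ofReal (∑ v ∈ F, M.stateDist σ α n v) := by
    rw [ENNReal.ofReal_sum_of_nonneg fun v _ ↦ M.stateDist_nonneg σ hα n v]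
    simp_rw [← M.uniformUnit_stateAt hσ hα]
    rw [← measure_biUnion_finset]
    · congr 1
      ext x
      simp
    · intro v _ w _ hvw
      exact Set.disjoint_left.2 fun x hx hx' ↦ hvw (hx.symm.trans hx')
    · exact fun v _ ↦ seedsBefore_le _ _ (M.measurable_stateAt hσ α n (measurableSet_singleton v))
  rw [PrReach, PrEvent, ← ENNReal.ofReal_le_iff_le_toReal hfin, ← hF,
    Measure.restrict_apply' measurableSet_Ico]
  exact measure_mono hsub

end MDP

end Memoryless

section Flow

namespace MDP

variable {V A : Type} [Fintype V] [Fintype A] [DecidableEq V]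

/-- The flow of an LP solution through `v'` is transported by the induced transitions. -/
lemma flow_eq_sum_transition (M : MDP V A) {F : Finset V} {y : V → A → ℝ} {σ : M.Strategy}
    (hy : ∀ v ∉ F, ∀ a ∈ M.enabled v, 0 ≤ y v a)
    (hσ : ∀ v, v ∉ F → 0 < ∑ a' ∈ M.enabled v, y v a' →
      ∀ a ∈ M.enabled v, σ.act [] v a = y v a / ∑ a' ∈ M.enabled v, y v a') (v : V) :
    ∑ v' ∈ Fᶜ, ∑ a' ∈ M.enabled v', M.p v' a' v * y v' a' =
      ∑ v' ∈ Fᶜ, (∑ a ∈ M.enabled v', y v' a) * M.transition σ v' v := by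
  refine Finset.sum_congr rfl fun v' hv' ↦ ?_
  have hF := Finset.mem_compl.1 hv'
  rw [transition_eq_sum_enabled, Finset.mul_sum]
  refine Finset.sum_congr rfl fun a ha ↦ ?_
  rcases (Finset.sum_nonneg (hy v' hF)).eq_or_lt with h | h
  · rw [← h, (Finset.sum_eq_zero_iff_of_nonneg (hy v' hF)).1 h.symm a ha]
    simp
  · rw [hσ v' hF h a ha, ← mul_assoc, mul_div_cancel₀ _ h.ne', mul_comm]

lemma transition_of_absorbing (M : MDP V A) (σ : M.Strategy) {v : V} (hv : M.Absorbing v) :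
    M.transition σ v v = 1 ∧ ∀ w, w ≠ v → M.transition σ v w = 0 := by
  have h1 : M.transition σ v v = 1 := by
    obtain ⟨a, ha, hp⟩ := hv
    have hact : σ.act [] v a = 1 := by
      rw [← σ.act_sum [] v, eq_comm]
      exact Finset.sum_eq_single a
        (fun b _ hb ↦ σ.act_support _ _ _ (by simpa [ha] using hb)) (by simp)
    rw [transition_eq_sum_enabled, ha, Finset.sum_singleton, hact, hp, one_mul]
  refine ⟨h1, fun w hw ↦ ?_⟩
  have hs := M.sum_transition σ v
  rw [← Finset.add_sum_erase _ _ (Finset.mem_univ v), h1, add_eq_left] at hs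
  exact (Finset.sum_eq_zero_iff_of_nonneg fun u _ ↦ M.transition_nonneg σ v u).1 hs w
    (by simp [hw])

lemma stateDist_succ_of_notMem (M : MDP V A) (σ : M.Strategy) (α : V → ℝ) {F : Finset V}
    (habs : ∀ v ∈ F, M.Absorbing v) (n : ℕ) {v : V} (hv : v ∉ F) :
    M.stateDist σ α (n + 1) v = ∑ v' ∈ Fᶜ, M.stateDist σ α n v' * M.transition σ v' v := by
  refine (Finset.sum_subset (Finset.subset_univ _) fun u _ hu ↦ ?_).symm
  have hu' : u ∈ F := by simpa using hu
  rw [(M.transition_of_absorbing σ (habs u hu')).2 v (by rintro rfl; exact hv hu'), mul_zero]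

lemma stateDist_succ_of_mem (M : MDP V A) (σ : M.Strategy) (α : V → ℝ) {F : Finset V}
    (habs : ∀ v ∈ F, M.Absorbing v) (n : ℕ) {v : V} (hv : v ∈ F) :
    M.stateDist σ α (n + 1) v =
      M.stateDist σ α n v + ∑ v' ∈ Fᶜ, M.stateDist σ α n v' * M.transition σ v' v := by
  simp only [stateDist]
  rw [← Finset.sum_add_sum_compl F]
  congr 1
  rw [Finset.sum_eq_single_of_mem v hv fun u hu huv ↦ by
    rw [(M.transition_of_absorbing σ (habs u hu)).2 v huv.symm, mul_zero],
    (M.transition_of_absorbing σ (habs v hv)).1, mul_one]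

/-- The state distributions exhaust the flow `yF` into the absorbing set `F`: what circulates
outside `F` for ever never reaches it. -/
lemma exists_flow_sub_stateDist_lt (M : MDP V A) (σ : M.Strategy) {α w yF : V → ℝ}
    {F : Finset V} (habs : ∀ v ∈ F, M.Absorbing v)
    (hw0 : ∀ v ∉ F, 0 ≤ w v)
    (hw : ∀ v ∉ F, w v = α v + ∑ v' ∈ Fᶜ, w v' * M.transition σ v' v)
    (hyF : ∀ v ∈ F, yF v = ∑ v' ∈ Fᶜ, w v' * M.transition σ v' v)
    (hsupp : ∀ v ∈ F, α v = 0) {G : Finset V} (hG : G ⊆ F) {ε : ℝ} (hε : 0 < ε) :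
    ∃ n, ∑ v ∈ G, yF v - ε < ∑ v ∈ G, M.stateDist σ α n v := by
  set R : ℕ → V → ℝ := fun n v ↦ w v - ∑ i ∈ Finset.range n, M.stateDist σ α i v with hR
  have hsum (n : ℕ) (v : V) : ∑ v' ∈ Fᶜ, R n v' * M.transition σ v' v =
      ∑ v' ∈ Fᶜ, w v' * M.transition σ v' v -
        ∑ i ∈ Finset.range n, ∑ v' ∈ Fᶜ, M.stateDist σ α i v' * M.transition σ v' v := by
    simp only [hR, sub_mul, Finset.sum_mul, Finset.sum_sub_distrib]
    rw [Finset.sum_comm]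
  have hRsucc (n : ℕ) (v : V) (hv : v ∉ F) :
      R (n + 1) v = ∑ v' ∈ Fᶜ, R n v' * M.transition σ v' v := by
    rw [hsum, ← Finset.sum_congr rfl fun i _ ↦ M.stateDist_succ_of_notMem σ α habs i hv]
    simp only [hR]
    rw [Finset.sum_range_succ', hw v hv]
    simp only [stateDist]
    ring
  have hR0 (n : ℕ) : ∀ v ∉ F, 0 ≤ R n v := by
    induction n with
    | zero => simpa [hR] using hw0
    | succ n ih =>
      intro v hv
      rw [hRsucc n v hv]
      exact Finset.sum_nonneg fun u hu ↦
        mul_nonneg (ih u (Finset.mem_compl.1 hu)) (M.transition_nonneg σ u v)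
  have hdist (n : ℕ) (v : V) (hv : v ∈ F) : M.stateDist σ α n v =
      ∑ i ∈ Finset.range n, ∑ v' ∈ Fᶜ, M.stateDist σ α i v' * M.transition σ v' v := by
    induction n with
    | zero => simpa [stateDist] using hsupp v hv
    | succ n ih => rw [M.stateDist_succ_of_mem σ α habs n hv, ih, Finset.sum_range_succ]
  have hrem (n : ℕ) (v : V) (hv : v ∈ F) :
      yF v - M.stateDist σ α n v = ∑ v' ∈ Fᶜ, R n v' * M.transition σ v' v := by
    rw [hyF v hv, hdist n v hv, hsum]
  set T : ℕ → ℝ := fun n ↦ ∑ v ∈ Fᶜ, R n v with hT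
  have hT0 (n : ℕ) : 0 ≤ T n := Finset.sum_nonneg fun v hv ↦ hR0 n v (Finset.mem_compl.1 hv)
  have hleak (n : ℕ) : ∑ v ∈ F, (yF v - M.stateDist σ α n v) = T n - T (n + 1) := by
    rw [eq_sub_iff_add_eq, Finset.sum_congr rfl (hrem n), hT]
    simp only
    rw [Finset.sum_congr rfl fun v hv ↦ hRsucc n v (Finset.mem_compl.1 hv),
      Finset.sum_add_sum_compl, Finset.sum_comm]
    simp_rw [← Finset.mul_sum, M.sum_transition, mul_one]
  have hterm0 (n : ℕ) (v : V) (hv : v ∈ F) : 0 ≤ yF v - M.stateDist σ α n v := by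
    rw [hrem n v hv]
    exact Finset.sum_nonneg fun u hu ↦
      mul_nonneg (hR0 n u (Finset.mem_compl.1 hu)) (M.transition_nonneg σ u v)
  obtain ⟨n, hn⟩ : ∃ n, T n - T (n + 1) < ε := by
    by_contra! h
    obtain ⟨N, hN⟩ := exists_nat_gt (T 0 / ε)
    have hbound (m : ℕ) : T m ≤ T 0 - m * ε := by
      induction m with
      | zero => simp
      | succ m ih => push_cast; linarith [h m]
    rw [div_lt_iff₀ hε] at hN
    linarith [hbound N, hT0 N]
  refine ⟨n, ?_⟩
  have hGF : ∑ v ∈ G, (yF v - M.stateDist σ α n v) ≤ ∑ v ∈ F, (yF v - M.stateDist σ α n v) :=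
    Finset.sum_le_sum_of_subset_of_nonneg hG fun v hv _ ↦ hterm0 n v hv
  rw [hleak, Finset.sum_sub_distrib] at hGF
  linarith

end MDP

end Flow

open MDP in
/-- Given a feasible LP solution `y''` with `∑_{v ∈ F_i} y''_v ≥ r_i > 0` for all `i`,
any memoryless strategy `σ` that at each state `v` of
`S = {v ∈ V∖F : ∑_γ y''_{(v,γ)} > 0}` plays `γ` with probability
`y''_{(v,γ)} / ∑_{γ'} y''_{(v,γ')}` (and is arbitrary outside `S`) satisfies
`Pr^σ_α(◇F_i) ≥ r_i` for all `i`. -/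
theorem strategy_from_lp_solution_achieves
    {V A : Type} [Fintype V] [Fintype A] [Nonempty V] [Nonempty A] [DecidableEq V]
    (M : MDP V A) {k : ℕ} (Fi : Fin k → Finset V) (F : Finset V)
    (hF : F = Finset.univ.biUnion Fi)
    (habs : ∀ v ∈ F, M.Absorbing v)
    (α : V → ℝ) (hα : IsDist α) (hsupp : ∀ v ∈ F, α v = 0)
    (y : V → A → ℝ) (yF : V → ℝ) (hy : M.LPFeasible α F y yF)
    (r : Fin k → ℝ) (hr : ∀ i, 0 < r i ∧ r i ≤ ∑ v ∈ Fi i, yF v)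
    (σ : M.Strategy) (hσm : σ.Memoryless)
    (hσ : ∀ v, v ∉ F → 0 < ∑ a' ∈ M.enabled v, y v a' →
      ∀ a ∈ M.enabled v, σ.act [] v a = y v a / ∑ a' ∈ M.enabled v, y v a') :
    ∀ i, r i ≤ M.PrReach σ α (↑(Fi i) : Set V) := by
  intro i
  obtain ⟨hflow, hin, -, hy0⟩ := hy
  have hsub : Fi i ⊆ F := hF ▸ Finset.subset_biUnion_of_mem Fi (Finset.mem_univ i)
  refine (hr i).2.trans (le_of_forall_pos_le_add fun ε hε ↦ ?_)
  obtain ⟨n, hn⟩ := M.exists_flow_sub_stateDist_lt σ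
    (yF := yF) (w := fun v ↦ ∑ a ∈ M.enabled v, y v a) habs (fun v hv ↦ Finset.sum_nonneg (hy0 v hv))
    (fun v hv ↦ by
      rw [← M.flow_eq_sum_transition hy0 hσ]
      exact sub_eq_iff_eq_add.1 (hflow v hv))
    (fun v hv ↦ by
      rw [← M.flow_eq_sum_transition hy0 hσ]
      exact sub_eq_zero.1 (hin v hv))
    hsupp hsub hε
  linarith [M.sum_stateDist_le_PrReach hσm hα n (Fi i)]
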